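/- arXiv:1802.06662 — 2 statements merged into one kernel-verified Lean document; each statement's English description precedes it below -/
import Mathlib

section
/- Let κ > 0, R₀ > 0, let V : ℝ³ → ℝ be continuous with V(x) = 0 for |x| ≥ R₀, and let f : ℝ³ → ℝ be twice continuously differentiable such that Δf(x) = (κ/2) V(x) f(x) for all x ∈ ℝ³ (where Δf is the sum of the second partial derivatives of f), and such that for some real number a one has f(x) = 1 − a/|x| for all |x| ≥ R₀. Then κ ∫_{ℝ³} V(x) f(x) dx = 8πa. -/
open MeasureTheory

/-- The Laplacian of `f : ℝ³ → ℝ`, defined as the sum of the second partial derivatives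
in the coordinate directions. -/
noncomputable def laplacian3 (f : EuclideanSpace ℝ (Fin 3) → ℝ)
    (x : EuclideanSpace ℝ (Fin 3)) : ℝ :=
  ∑ i : Fin 3,
    fderiv ℝ (fun y => fderiv ℝ f y (EuclideanSpace.single i (1 : ℝ))) x
      (EuclideanSpace.single i (1 : ℝ))

open Set Filter Topology

/-- Green's first identity on `ℝ³` against a compactly supported function. -/
lemma integral_mul_laplacian3_eq_neg_sum {f φ : EuclideanSpace ℝ (Fin 3) → ℝ}
    (hf : ContDiff ℝ 2 f) (hφ : ContDiff ℝ 1 φ) (hc : HasCompactSupport φ) :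
    ∫ x, φ x * laplacian3 f x =
      -∫ x, ∑ i : Fin 3, fderiv ℝ φ x (EuclideanSpace.single i (1 : ℝ)) *
        fderiv ℝ f x (EuclideanSpace.single i (1 : ℝ)) := by
  have hpartial : ∀ i : Fin 3,
      ContDiff ℝ 1 (fun y => fderiv ℝ f y (EuclideanSpace.single i (1 : ℝ))) := fun i =>
    (hf.fderiv_right (m := 1) (by norm_num)).clm_apply contDiff_const
  have hφ' : ∀ i : Fin 3,
      Continuous (fun x => fderiv ℝ φ x (EuclideanSpace.single i (1 : ℝ))) := fun i =>
    (hφ.continuous_fderiv one_ne_zero).clm_apply continuous_const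
  have hf'' : ∀ i : Fin 3, Continuous (fun x =>
      fderiv ℝ (fun y => fderiv ℝ f y (EuclideanSpace.single i (1 : ℝ))) x
        (EuclideanSpace.single i (1 : ℝ))) := fun i =>
    ((hpartial i).continuous_fderiv one_ne_zero).clm_apply continuous_const
  have hleft : ∀ i : Fin 3, Integrable (fun x =>
      fderiv ℝ φ x (EuclideanSpace.single i (1 : ℝ)) *
        fderiv ℝ f x (EuclideanSpace.single i (1 : ℝ))) := fun i =>
    ((hφ' i).mul (hpartial i).continuous).integrable_of_hasCompactSupport
      (hc.fderiv_apply ℝ _).mul_right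
  have hright : ∀ i : Fin 3, Integrable (fun x => φ x *
      fderiv ℝ (fun y => fderiv ℝ f y (EuclideanSpace.single i (1 : ℝ))) x
        (EuclideanSpace.single i (1 : ℝ))) := fun i =>
    (hφ.continuous.mul (hf'' i)).integrable_of_hasCompactSupport hc.mul_right
  simp only [laplacian3, Finset.mul_sum]
  rw [integral_finsetSum _ fun i _ => hright i, integral_finsetSum _ fun i _ => hleft i,
    ← Finset.sum_neg_distrib]
  refine Finset.sum_congr rfl fun i _ => ?_
  exact integral_mul_fderiv_eq_neg_fderiv_mul_of_integrable (hleft i) (hright i)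
    ((hφ.continuous.mul (hpartial i).continuous).integrable_of_hasCompactSupport hc.mul_right)
    (fun x _ => hφ.differentiable one_ne_zero x)
    (fun x _ => (hpartial i).differentiable one_ne_zero x)

/-- The gradient of `x ↦ s (‖x‖ ^ 2)` paired with the gradient of `f`. -/
lemma sum_fderiv_comp_norm_sq_mul_fderiv {s : ℝ → ℝ} (hs : Differentiable ℝ s)
    (f : EuclideanSpace ℝ (Fin 3) → ℝ) (x : EuclideanSpace ℝ (Fin 3)) :
    ∑ i : Fin 3, fderiv ℝ (fun y => s (‖y‖ ^ 2)) x (EuclideanSpace.single i (1 : ℝ)) *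
        fderiv ℝ f x (EuclideanSpace.single i (1 : ℝ)) =
      2 * deriv s (‖x‖ ^ 2) * fderiv ℝ f x x := by
  have hfd : HasFDerivAt (fun y : EuclideanSpace ℝ (Fin 3) => s (‖y‖ ^ 2))
      (deriv s (‖x‖ ^ 2) • (2 • innerSL ℝ x)) x :=
    (hs (‖x‖ ^ 2)).hasDerivAt.comp_hasFDerivAt x (hasStrictFDerivAt_norm_sq x).hasFDerivAt
  have hx : fderiv ℝ f x x = ∑ i : Fin 3, x i * fderiv ℝ f x (EuclideanSpace.single i 1) := by
    have hsum := congrArg (fderiv ℝ f x) ((EuclideanSpace.basisFun (Fin 3) ℝ).sum_repr x)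
    rw [← hsum, map_sum]
    simp
  rw [hfd.fderiv, hx, Finset.mul_sum]
  refine Finset.sum_congr rfl fun i _ => ?_
  simp [EuclideanSpace.inner_single_right]
  ring

/-- The radial derivative of a function equal to `1 - a / ‖x‖` outside a ball. -/
lemma fderiv_apply_self_of_eq_one_sub_div_norm {E : Type*} [NormedAddCommGroup E]
    [NormedSpace ℝ E] {f : E → ℝ} {R a : ℝ}
    (hout : ∀ x : E, R ≤ ‖x‖ → f x = 1 - a / ‖x‖) {x : E} (hx : R < ‖x‖)
    (hf : DifferentiableAt ℝ f x) : fderiv ℝ f x x = a / ‖x‖ := by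
  have hline : HasDerivAt (fun t : ℝ => f (t • x)) (fderiv ℝ f x x) 1 := by
    have hsmul : HasDerivAt (fun t : ℝ => t • x) x 1 := by
      simpa using (hasDerivAt_id (1 : ℝ)).smul_const x
    have hfx : HasFDerivAt f (fderiv ℝ f x) ((1 : ℝ) • x) := by
      simpa using hf.hasFDerivAt
    exact hfx.comp_hasDerivAt 1 hsmul
  have heq : (fun t : ℝ => f (t • x)) =ᶠ[𝓝 1] fun t => 1 - a / ‖x‖ * t⁻¹ := by
    have hcont : ContinuousAt (fun t : ℝ => ‖t • x‖) 1 := by fun_prop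
    filter_upwards [hcont.eventually (lt_mem_nhds (by simpa using hx)),
      lt_mem_nhds (zero_lt_one : (0 : ℝ) < 1)] with t ht ht0
    rw [hout _ ht.le, norm_smul, Real.norm_of_nonneg ht0.le]
    field_simp
  have hexp : HasDerivAt (fun t : ℝ => 1 - a / ‖x‖ * t⁻¹) (a / ‖x‖) 1 := by
    simpa using ((hasDerivAt_inv (one_ne_zero (α := ℝ))).const_mul (a / ‖x‖)).const_sub 1
  exact hline.unique (hexp.congr_of_eventuallyEq heq)

/-- The flux of `1 - a / ‖x‖` measured through a radial cutoff. -/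
lemma integral_two_mul_deriv_norm_sq_mul_div_norm {s : ℝ → ℝ} (hs : ContDiff ℝ 1 s) {M : ℝ}
    (hM : ∀ t, M ≤ t → s t = 0) (a : ℝ) :
    ∫ x : EuclideanSpace ℝ (Fin 3), 2 * deriv s (‖x‖ ^ 2) * (a / ‖x‖) =
      -(4 * Real.pi * a * s 0) := by
  have hderiv : ∀ r : ℝ, HasDerivAt (fun r => s (r ^ 2)) (2 * r * deriv s (r ^ 2)) r := by
    intro r
    refine ((hs.differentiable one_ne_zero (r ^ 2)).hasDerivAt.comp r
      (hasDerivAt_pow 2 r)).congr_deriv ?_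
    push_cast
    ring
  have hzero : ∀ r : ℝ, max M 0 + 1 < |r| → s (r ^ 2) = 0 := by
    intro r hr
    refine hM _ ?_
    rw [← sq_abs]
    nlinarith [le_max_left M 0, le_max_right M 0]
  have hc : HasCompactSupport (fun r : ℝ => s (r ^ 2)) :=
    HasCompactSupport.intro (isCompact_closedBall (0 : ℝ) (max M 0 + 1)) fun r hr => by
      refine hzero r ?_
      simpa using hr
  have hint : IntegrableOn (fun r : ℝ => 2 * r * deriv s (r ^ 2)) (Ioi 0) := by
    refine Integrable.integrableOn ?_
    have hcont : Continuous (fun r : ℝ => 2 * r * deriv s (r ^ 2)) := by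
      have := hs.continuous_deriv le_rfl
      fun_prop
    refine hcont.integrable_of_hasCompactSupport ?_
    have := hc.deriv
    rwa [show deriv (fun r : ℝ => s (r ^ 2)) = fun r => 2 * r * deriv s (r ^ 2) from
      funext fun r => (hderiv r).deriv] at this
  have hlim : Tendsto (fun r : ℝ => s (r ^ 2)) atTop (𝓝 0) := by
    refine tendsto_const_nhds.congr' ?_
    filter_upwards [eventually_gt_atTop (max M 0 + 1)] with r hr
    exact (hzero r (hr.trans_le (le_abs_self r))).symm
  have hFTC := integral_Ioi_of_hasDerivAt_of_tendsto' (fun r _ => hderiv r) hint hlim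
  rw [integral_fun_norm_addHaar volume fun r : ℝ => 2 * deriv s (r ^ 2) * (a / r)]
  have hradial : ∫ r in Ioi (0 : ℝ), r ^ (Module.finrank ℝ (EuclideanSpace ℝ (Fin 3)) - 1) •
      (2 * deriv s (r ^ 2) * (a / r)) = a * -s 0 := by
    rw [show -s 0 = 0 - s (0 ^ 2) by simp, ← hFTC, ← integral_const_mul]
    refine setIntegral_congr_fun measurableSet_Ioi fun r hr => ?_
    have hr0 : r ≠ 0 := ne_of_gt hr
    simp
    field_simp
  have hball : volume.real (Metric.ball (0 : EuclideanSpace ℝ (Fin 3)) 1) = Real.pi * 4 / 3 := by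
    rw [measureReal_def, EuclideanSpace.volume_ball_fin_three]
    simp [ENNReal.toReal_ofReal (show 0 ≤ Real.pi * 4 / 3 by positivity)]
  rw [hradial, hball]
  simp
  ring

/-- Integral characterization of the scattering length: if `f` is `C²`, solves
`Δf = (κ/2) V f` on `ℝ³`, and is equal to `1 − a/|x|` for `|x| ≥ R₀` (where the continuous
potential `V` vanishes for `|x| ≥ R₀`), then `κ ∫ V f = 8πa`. -/
theorem scattering_length_integral_formula (κ R₀ : ℝ) (hκ : 0 < κ) (hR₀ : 0 < R₀)
    (V : EuclideanSpace ℝ (Fin 3) → ℝ) (hVcont : Continuous V)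
    (hVsupp : ∀ x : EuclideanSpace ℝ (Fin 3), R₀ ≤ ‖x‖ → V x = 0)
    (f : EuclideanSpace ℝ (Fin 3) → ℝ) (hf : ContDiff ℝ 2 f)
    (hscat : ∀ x : EuclideanSpace ℝ (Fin 3), laplacian3 f x = κ / 2 * V x * f x)
    (a : ℝ)
    (hout : ∀ x : EuclideanSpace ℝ (Fin 3), R₀ ≤ ‖x‖ → f x = 1 - a / ‖x‖) :
    κ * ∫ x : EuclideanSpace ℝ (Fin 3), V x * f x = 8 * Real.pi * a := by
  set s : ℝ → ℝ := fun t => Real.smoothTransition (3 - t / R₀ ^ 2)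
  have hR2 : 0 < R₀ ^ 2 := by positivity
  have hs : ContDiff ℝ 1 s := Real.smoothTransition.contDiff.comp (by fun_prop)
  have hs_one : ∀ t, t ≤ 2 * R₀ ^ 2 → s t = 1 := fun t ht =>
    Real.smoothTransition.one_of_one_le (by linarith [(div_le_iff₀ hR2).2 ht])
  have hs_zero : ∀ t, 3 * R₀ ^ 2 ≤ t → s t = 0 := fun t ht =>
    Real.smoothTransition.zero_of_nonpos (by linarith [(le_div_iff₀ hR2).2 ht])
  set φ : EuclideanSpace ℝ (Fin 3) → ℝ := fun x => s (‖x‖ ^ 2)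
  have hφ : ContDiff ℝ 1 φ := hs.comp (contDiff_norm_sq ℝ)
  have hc : HasCompactSupport φ :=
    HasCompactSupport.intro (isCompact_closedBall 0 (2 * R₀)) fun x hx => by
      have hx' : 2 * R₀ < ‖x‖ := by simpa using hx
      exact hs_zero _ (by nlinarith)
  have hcut : ∀ x, φ x * laplacian3 f x = κ / 2 * (V x * f x) := by
    intro x
    rw [hscat]
    rcases le_total R₀ ‖x‖ with hx | hx
    · simp [hVsupp x hx]
    · have : φ x = 1 := hs_one _ (by nlinarith [norm_nonneg x])
      rw [this]
      ring
  have hgrad : ∀ x, ∑ i : Fin 3, fderiv ℝ φ x (EuclideanSpace.single i (1 : ℝ)) *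
      fderiv ℝ f x (EuclideanSpace.single i (1 : ℝ)) =
        2 * deriv s (‖x‖ ^ 2) * (a / ‖x‖) := by
    intro x
    rw [sum_fderiv_comp_norm_sq_mul_fderiv (hs.differentiable one_ne_zero) f x]
    rcases le_or_gt ‖x‖ R₀ with hx | hx
    · have hconst : s =ᶠ[𝓝 (‖x‖ ^ 2)] fun _ => 1 := by
        filter_upwards [gt_mem_nhds (show ‖x‖ ^ 2 < 2 * R₀ ^ 2 by
          nlinarith [norm_nonneg x])] with t ht
        exact hs_one t ht.le
      simp [hconst.deriv_eq]
    · rw [fderiv_apply_self_of_eq_one_sub_div_norm hout hx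
        (hf.differentiable two_ne_zero x)]
  have hgreen := integral_mul_laplacian3_eq_neg_sum hf hφ hc
  simp only [hcut, hgrad] at hgreen
  rw [integral_const_mul, integral_two_mul_deriv_norm_sq_mul_div_norm hs hs_zero,
    hs_one 0 (by positivity)] at hgreen
  linarith
end

section
/- Let s > 1 and let g : ℝ³ → ℝ be continuous with |g(q)| ≤ C₀(1 + |q|)^{−s} for all q ∈ ℝ³ and some constant C₀ > 0. Then lim_{N→∞} (2π/N)³ ∑_{p ∈ 2πℤ³, p ≠ 0} g(p/N)/|p/N|² = ∫_{ℝ³} g(q)/|q|² dq; in particular both the lattice sums and the integral are absolutely convergent. -/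
open MeasureTheory Filter

/-- The lattice point `2π n ∈ 2πℤ³`, regarded as a vector in `ℝ³`. -/
noncomputable def lat (n : Fin 3 → ℤ) : EuclideanSpace ℝ (Fin 3) :=
  (WithLp.equiv 2 (Fin 3 → ℝ)).symm (fun i => 2 * Real.pi * n i)

/-- The coordinatewise floor on `ℝ^ι`. -/
noncomputable def coordFloor {ι : Type*} (x : EuclideanSpace ℝ ι) : ι → ℤ := fun i => ⌊x i⌋

lemma measurable_coordFloor {ι : Type*} [Fintype ι] :
    Measurable (coordFloor : EuclideanSpace ℝ ι → ι → ℤ) :=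
  measurable_pi_lambda _ fun i =>
    Int.measurable_floor.comp (EuclideanSpace.proj (𝕜 := ℝ) i).continuous.measurable

/-- The unit cells with corners in `ℤ^ι` have volume one. -/
lemma map_coordFloor_volume {ι : Type*} [Fintype ι] :
    Measure.map (coordFloor : EuclideanSpace ℝ ι → ι → ℤ) volume = Measure.count := by
  refine Measure.ext_of_singleton fun n => ?_
  rw [Measure.map_apply measurable_coordFloor (measurableSet_singleton n), Measure.count_singleton]
  have hcell : (coordFloor : EuclideanSpace ℝ ι → ι → ℤ) ⁻¹' {n} =
      (MeasurableEquiv.toLp 2 (ι → ℝ)).symm ⁻¹'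
        (Set.univ.pi fun i => Set.Ico (n i : ℝ) (n i + 1)) := by
    ext x
    simp [coordFloor, funext_iff, Int.floor_eq_iff]
  rw [hcell, (EuclideanSpace.volume_preserving_symm_measurableEquiv_toLp ι).measure_preimage_equiv,
    Real.volume_pi_Ico]
  simp

lemma integrable_comp_coordFloor_iff {ι : Type*} [Fintype ι] {f : (ι → ℤ) → ℝ} :
    Integrable (fun x : EuclideanSpace ℝ ι => f (coordFloor x)) ↔ Summable fun n => |f n| := by
  have hf : AEStronglyMeasurable f
      (Measure.map (coordFloor : EuclideanSpace ℝ ι → ι → ℤ) volume) :=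
    (measurable_of_countable f).aestronglyMeasurable
  have := integrable_map_measure hf measurable_coordFloor.aemeasurable
  rw [map_coordFloor_volume, integrable_count_iff] at this
  exact this.symm

lemma integral_comp_coordFloor {ι : Type*} [Fintype ι] {f : (ι → ℤ) → ℝ}
    (hf : Summable fun n => |f n|) :
    ∫ x : EuclideanSpace ℝ ι, f (coordFloor x) = ∑' n, f n := by
  have hf' : Integrable f Measure.count := integrable_count_iff.2 hf
  rw [← integral_map (f := f) measurable_coordFloor.aemeasurable
    (measurable_of_countable f).aestronglyMeasurable, map_coordFloor_volume,
    integral_countable hf']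
  simp [Measure.real]

lemma integrable_one_add_norm_rpow_div_norm_sq {s : ℝ} (hs : 1 < s) :
    Integrable fun q : EuclideanSpace ℝ (Fin 3) => (1 + ‖q‖) ^ (-s) / ‖q‖ ^ 2 := by
  rw [integrable_fun_norm_addHaar volume (f := fun r : ℝ => (1 + r) ^ (-s) / r ^ 2)]
  refine (integrableOn_add_rpow_Ioi_of_lt (a := -s) (c := 0) (m := 1)
    (by linarith) (by norm_num)).congr_fun (fun r hr => ?_) measurableSet_Ioi
  have hr0 : r ≠ 0 := (Set.mem_Ioi.1 hr).ne'
  simp only [finrank_euclideanSpace, Fintype.card_fin, smul_eq_mul]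
  field_simp
  rw [add_comm]

/-- The corner of the cell of the lattice `hℤ³` that contains `q`. -/
noncomputable def cellCorner (h : ℝ) (q : EuclideanSpace ℝ (Fin 3)) : EuclideanSpace ℝ (Fin 3) :=
  (h / (2 * Real.pi)) • lat (coordFloor (h⁻¹ • q))

lemma cellCorner_apply (h : ℝ) (q : EuclideanSpace ℝ (Fin 3)) (i : Fin 3) :
    cellCorner h q i = h * ⌊h⁻¹ * q i⌋ := by
  simp [cellCorner, lat, coordFloor]
  field_simp

lemma measurable_cellCorner (h : ℝ) : Measurable (cellCorner h) :=
  (measurable_of_countable fun n : Fin 3 → ℤ => (h / (2 * Real.pi)) • lat n).comp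
    (measurable_coordFloor.comp (measurable_const_smul h⁻¹))

lemma norm_sub_cellCorner_le {h : ℝ} (hh : 0 < h) (q : EuclideanSpace ℝ (Fin 3)) :
    ‖q - cellCorner h q‖ ≤ 2 * h := by
  have hcoord (i : Fin 3) : (q i - cellCorner h q i) ^ 2 ≤ h ^ 2 := by
    have h1 : q i - cellCorner h q i = h * Int.fract (h⁻¹ * q i) := by
      rw [cellCorner_apply, Int.fract]
      field_simp
    rw [h1, mul_pow]
    have h2 := Int.fract_nonneg (h⁻¹ * q i)
    have h3 := (Int.fract_lt_one (h⁻¹ * q i)).le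
    exact mul_le_of_le_one_right (by positivity) (pow_le_one₀ h2 h3)
  refine abs_le_of_sq_le_sq' ?_ (by positivity) |>.2
  rw [EuclideanSpace.real_norm_sq_eq, Fin.sum_univ_three]
  simp only [PiLp.sub_apply]
  nlinarith [hcoord 0, hcoord 1, hcoord 2, sq_nonneg h]

lemma le_norm_cellCorner {h : ℝ} (hh : 0 < h) {q : EuclideanSpace ℝ (Fin 3)}
    (hq : cellCorner h q ≠ 0) : h ≤ ‖cellCorner h q‖ := by
  obtain ⟨i, hi⟩ : ∃ i, cellCorner h q i ≠ 0 := by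
    by_contra! hall
    exact hq (PiLp.ext hall)
  rw [cellCorner_apply] at hi
  have hfloor : (1 : ℝ) ≤ |(⌊h⁻¹ * q i⌋ : ℝ)| := by
    exact_mod_cast Int.one_le_abs (by rintro h0; simp [h0] at hi : ⌊h⁻¹ * q i⌋ ≠ 0)
  calc h ≤ h * |(⌊h⁻¹ * q i⌋ : ℝ)| := le_mul_of_one_le_right hh.le hfloor
    _ = ‖cellCorner h q i‖ := by rw [cellCorner_apply, Real.norm_eq_abs, abs_mul, abs_of_pos hh]
    _ ≤ ‖cellCorner h q‖ := PiLp.norm_apply_le _ i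

lemma norm_le_three_mul_norm_cellCorner {h : ℝ} (hh : 0 < h) {q : EuclideanSpace ℝ (Fin 3)}
    (hq : cellCorner h q ≠ 0) : ‖q‖ ≤ 3 * ‖cellCorner h q‖ := by
  have h1 := norm_sub_cellCorner_le hh q
  have h2 := le_norm_cellCorner hh hq
  have h3 := norm_sub_norm_le q (cellCorner h q)
  linarith

lemma tendsto_cellCorner {α : Type*} {l : Filter α} {h : α → ℝ} (hpos : ∀ a, 0 ≤ h a)
    (hlim : Tendsto h l (nhds 0)) {q : EuclideanSpace ℝ (Fin 3)} (hne : ∀ᶠ a in l, h a ≠ 0) :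
    Tendsto (fun a => cellCorner (h a) q) l (nhds q) := by
  rw [tendsto_iff_norm_sub_tendsto_zero]
  refine squeeze_zero' (.of_forall fun _ => norm_nonneg _) (hne.mono fun a ha => ?_)
    (by simpa using hlim.const_mul 2)
  rw [norm_sub_rev]
  exact norm_sub_cellCorner_le ((hpos a).lt_of_ne' ha) q

/-- Replacing `q` by the corner of its cell costs at most a constant factor in the decay bound,
because the cell at the origin does not contribute. -/
lemma abs_div_norm_sq_cellCorner_le {s C : ℝ} (hs : 0 ≤ s) {g : EuclideanSpace ℝ (Fin 3) → ℝ}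
    (hC : 0 ≤ C) (hdecay : ∀ q, |g q| ≤ C * (1 + ‖q‖) ^ (-s)) {h : ℝ} (hh : 0 < h)
    (q : EuclideanSpace ℝ (Fin 3)) :
    |g (cellCorner h q) / ‖cellCorner h q‖ ^ 2| ≤
      9 * 3 ^ s * C * ((1 + ‖q‖) ^ (-s) / ‖q‖ ^ 2) := by
  rcases eq_or_ne (cellCorner h q) 0 with h0 | h0
  · rw [h0, norm_zero, zero_pow two_ne_zero, div_zero, abs_zero]
    positivity
  have hle := norm_le_three_mul_norm_cellCorner hh h0
  set p := cellCorner h q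
  have hp : 0 < ‖p‖ := norm_pos_iff.2 h0
  rcases eq_or_ne q 0 with rfl | hq
  · exact absurd (by ext i; simp [p, cellCorner_apply]) h0
  have hq' : 0 < ‖q‖ := norm_pos_iff.2 hq
  have hpow : (1 + ‖p‖) ^ (-s) ≤ 3 ^ s * (1 + ‖q‖) ^ (-s) := by
    calc (1 + ‖p‖) ^ (-s) ≤ ((1 + ‖q‖) / 3) ^ (-s) :=
          Real.rpow_le_rpow_of_nonpos (by positivity) (by linarith) (by linarith)
      _ = 3 ^ s * (1 + ‖q‖) ^ (-s) := by
          rw [Real.div_rpow (by positivity) (by norm_num), Real.rpow_neg (x := 3) (by norm_num),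
            div_inv_eq_mul, mul_comm]
  have hinv : (‖p‖ ^ 2)⁻¹ ≤ 9 * (‖q‖ ^ 2)⁻¹ := by
    rw [← div_eq_mul_inv, inv_eq_one_div, div_le_div_iff₀ (by positivity) (by positivity)]
    nlinarith
  rw [abs_div, abs_of_nonneg (sq_nonneg ‖p‖), div_eq_mul_inv]
  calc |g p| * (‖p‖ ^ 2)⁻¹ ≤ (C * (3 ^ s * (1 + ‖q‖) ^ (-s))) * (9 * (‖q‖ ^ 2)⁻¹) := by
        gcongr
        exact (hdecay p).trans (by gcongr)
    _ = _ := by ring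

/-- Riemann-sum convergence with the singular weight `|q|⁻²`: if `g` is continuous with
`|g(q)| ≤ C₀(1+|q|)^{−s}` for some `s > 1`, then
`(2π/N)³ ∑_{p ∈ 2πℤ³∖{0}} g(p/N)/|p/N|² → ∫_{ℝ³} g(q)/|q|² dq` as `N → ∞`;
in particular the lattice sums and the integral are absolutely convergent. -/
theorem riemann_sum_singular_weight (s : ℝ) (hs : 1 < s)
    (g : EuclideanSpace ℝ (Fin 3) → ℝ) (hg : Continuous g)
    (C₀ : ℝ) (hC₀ : 0 < C₀)
    (hdecay : ∀ q : EuclideanSpace ℝ (Fin 3), |g q| ≤ C₀ * (1 + ‖q‖) ^ (-s)) :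
    Integrable (fun q : EuclideanSpace ℝ (Fin 3) => g q / ‖q‖ ^ 2) ∧
    (∀ N : ℕ, 1 ≤ N →
      Summable (fun n : {n : Fin 3 → ℤ // n ≠ 0} =>
        |g ((N : ℝ)⁻¹ • lat n.1)| / ‖(N : ℝ)⁻¹ • lat n.1‖ ^ 2)) ∧
    Tendsto (fun N : ℕ =>
        (2 * Real.pi / (N : ℝ)) ^ 3 *
          ∑' n : {n : Fin 3 → ℤ // n ≠ 0},
            g ((N : ℝ)⁻¹ • lat n.1) / ‖(N : ℝ)⁻¹ • lat n.1‖ ^ 2)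
      atTop (nhds (∫ q : EuclideanSpace ℝ (Fin 3), g q / ‖q‖ ^ 2)) := by
  have hs0 : 0 ≤ s := by linarith
  set F : EuclideanSpace ℝ (Fin 3) → ℝ := fun q => g q / ‖q‖ ^ 2 with hF
  have hFmeas : Measurable F := hg.measurable.div (measurable_norm.pow_const 2)
  have hdom := (integrable_one_add_norm_rpow_div_norm_sq hs).const_mul (9 * 3 ^ s * C₀)
  have hbound {h : ℝ} (hh : 0 < h) := abs_div_norm_sq_cellCorner_le hs0 hC₀.le hdecay hh
  have hstep {h : ℝ} (hh : 0 < h) : Integrable fun q => F (cellCorner h q) :=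
    hdom.mono' (hFmeas.comp (measurable_cellCorner h)).aestronglyMeasurable
      (.of_forall (hbound hh))
  have hmesh {N : ℕ} (hN : 1 ≤ N) : 0 < 2 * Real.pi / (N : ℝ) := by positivity
  have hcorner (N : ℕ) (q : EuclideanSpace ℝ (Fin 3)) :
      cellCorner (2 * Real.pi / N) q =
        (N : ℝ)⁻¹ • lat (coordFloor ((2 * Real.pi / (N : ℝ))⁻¹ • q)) := by
    rw [cellCorner]
    congr 1
    field_simp
  have hsum {N : ℕ} (hN : 1 ≤ N) : Summable fun n => |F ((N : ℝ)⁻¹ • lat n)| := by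
    rw [← integrable_comp_coordFloor_iff, ← integrable_comp_smul_iff volume
      (fun x => F ((N : ℝ)⁻¹ • lat (coordFloor x))) (inv_ne_zero (hmesh hN).ne')]
    simpa only [hcorner] using hstep (hmesh hN)
  refine ⟨?_, fun N hN => ?_, ?_⟩
  · refine ((integrable_one_add_norm_rpow_div_norm_sq hs).const_mul C₀).mono'
      hFmeas.aestronglyMeasurable (.of_forall fun q => ?_)
    rw [Real.norm_eq_abs, abs_div, abs_of_nonneg (sq_nonneg ‖q‖), ← mul_div_assoc]
    gcongr
    exact hdecay q
  · simpa [hF, abs_div, Function.comp_def] using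
      (hsum hN).comp_injective (Subtype.val_injective (p := fun n => n ≠ 0))
  have hzero : F 0 = 0 := by simp [hF]
  have hlat : lat 0 = 0 := by ext i; simp [lat]
  have hintegral {N : ℕ} (hN : 1 ≤ N) :
      ∫ q, F (cellCorner (2 * Real.pi / N) q) = (2 * Real.pi / (N : ℝ)) ^ 3 *
        ∑' n : {n : Fin 3 → ℤ // n ≠ 0}, F ((N : ℝ)⁻¹ • lat n.1) := by
    have hsupp : Function.support (fun n => F ((N : ℝ)⁻¹ • lat n)) ⊆ {n | n ≠ 0} := by
      rintro n hn rfl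
      simp [hlat, hzero] at hn
    have htsum : ∑' n : {n : Fin 3 → ℤ // n ≠ 0}, F ((N : ℝ)⁻¹ • lat n.1) =
        ∑' n, F ((N : ℝ)⁻¹ • lat n) := tsum_subtype_eq_of_support_subset hsupp
    simp only [hcorner]
    rw [Measure.integral_comp_smul volume (fun x => F ((N : ℝ)⁻¹ • lat (coordFloor x))),
      integral_comp_coordFloor (hsum hN), htsum, finrank_euclideanSpace, Fintype.card_fin,
      inv_pow, inv_inv, abs_of_pos (pow_pos (hmesh hN) 3), smul_eq_mul]
  have hlim : Tendsto (fun N : ℕ => 2 * Real.pi / (N : ℝ)) atTop (nhds 0) :=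
    tendsto_const_div_atTop_nhds_zero_nat _
  have hev := eventually_ge_atTop (1 : ℕ)
  refine (tendsto_integral_filter_of_dominated_convergence _
    (.of_forall fun N => (hFmeas.comp (measurable_cellCorner _)).aestronglyMeasurable)
    (hev.mono fun N hN => .of_forall (hbound (hmesh hN))) hdom ?_).congr'
    (hev.mono fun N hN => hintegral hN)
  filter_upwards [Measure.ae_ne volume 0] with q hq
  have hcont : ContinuousAt F q :=
    hg.continuousAt.div (by fun_prop) (pow_ne_zero 2 (norm_ne_zero_iff.2 hq))
  exact hcont.tendsto.comp (tendsto_cellCorner (fun N => by positivity) hlim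
    (hev.mono fun N hN => (hmesh hN).ne'))
end
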